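/- arXiv:math/0103021 — 5 statements merged into one kernel-verified Lean document; each statement's English description precedes it below -/
import Mathlib

section
/- Assume the parameters satisfy conditions (P2) and (P3). Then for all 1 ≤ k ≤ i ≤ n one has s_i b_{i+1−k,n−k} b_{i+1−k,n+1−k}^{−1} b_{i−k,n+1−k} b_{i−k,n−k}^{−1} = ε^{−λ_i}. -/
theorem parameter_specialization_lemma (l n : ℕ) (hlodd : Odd l) (hl : 1 < l)
    (ε : ℂ) (hε : IsPrimitiveRoot ε l) (hn : 1 ≤ n)
    (r s : ℕ → ℂ) (b : ℕ → ℕ → ℂ)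
    (hr : ∀ i, r i ≠ 0) (hs : ∀ i, s i ≠ 0) (hb : ∀ j k, b j k ≠ 0)
    (hbout : ∀ j k, ¬(1 ≤ j ∧ j ≤ k ∧ k ≤ n) → b j k = 1)
    (lam : ℕ → ℕ) (hlam : ∀ i, lam i < l)
    -- condition (P2)
    (hP2 : ∀ i k, 1 ≤ i → i ≤ k → k ≤ n →
      r i * (b i k * b i (k - 1) * (b (i - 1) (k - 1))⁻¹ * (b (i + 1) k)⁻¹) = 1)
    -- condition (P3)
    (hP3 : ∀ i, 1 ≤ i → i ≤ n →
      (r i / s i) * (b i n ^ 2 * (b (i - 1) n)⁻¹ * (b (i + 1) n)⁻¹) = ε ^ lam i) :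
    ∀ i k, 1 ≤ k → k ≤ i → i ≤ n →
      s i * (b (i + 1 - k) (n - k) * (b (i + 1 - k) (n + 1 - k))⁻¹ *
        b (i - k) (n + 1 - k) * (b (i - k) (n - k))⁻¹) = (ε ^ lam i)⁻¹ := by
  intro i k hk
  induction k, hk using Nat.le_induction with
  | base =>
    intro hi hin
    have h2 := hP2 i n hi hin le_rfl
    have h3 := hP3 i hi hin
    simp only [Nat.add_sub_cancel]
    rw [← h3]
    field_simp [hr, hs, hb] at h2 ⊢
    linear_combination h2
  | succ k hk ih =>
    intro hki hin
    rw [← ih (by omega) hin]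
    obtain ⟨p, rfl⟩ := Nat.exists_eq_add_of_le hki
    obtain ⟨q, rfl⟩ := Nat.exists_eq_add_of_le hin
    have h := hP2 (p + 1) (p + q + 1) (by omega) (by omega) (by omega)
    have h' := hP2 (p + 1) (p + q + 2) (by omega) (by omega) (by omega)
    rw [show k + 1 + p + 1 - (k + 1) = p + 1 by omega,
      show k + 1 + p + q - (k + 1) = p + q by omega,
      show k + 1 + p + q + 1 - (k + 1) = p + q + 1 by omega,
      show k + 1 + p - (k + 1) = p by omega,
      show k + 1 + p + 1 - k = p + 2 by omega,
      show k + 1 + p + q - k = p + q + 1 by omega,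
      show k + 1 + p + q + 1 - k = p + q + 2 by omega,
      show k + 1 + p - k = p + 1 by omega]
    rw [show p + q + 1 - 1 = p + q by omega, show p + 1 - 1 = p by omega] at h
    rw [show p + q + 2 - 1 = p + q + 1 by omega, show p + 1 - 1 = p by omega] at h'
    field_simp [hr, hs, hb] at h h' ⊢
    apply mul_left_cancel₀ (mul_ne_zero (hr (p + 1)) (hb (p + 1) (p + q + 1)))
    linear_combination b p (p + q + 1) * b (p + 2) (p + q + 2) * h -
      b p (p + q) * b (p + 2) (p + q + 1) * h'
end

section
/- The root vectors f_{[j,k]} satisfy the following commutation relations in A: (i) for 1 ≤ j ≤ k ≤ n and any i with 1 ≤ i ≤ j−2 or j < i < k, one has f_i f_{[j,k]} = f_{[j,k]} f_i; (ii) for 2 ≤ j ≤ k ≤ n, one has ε f_{j−1} f_{[j−1,k]} = f_{[j−1,k]} f_{j−1}; (iii) for 2 ≤ j ≤ k ≤ n, one has ε f_{[j−1,k]} f_{[j,k]} = f_{[j,k]} f_{[j−1,k]}. -/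
noncomputable section

/-- Auxiliary recursive definition of the negative root vectors:
`rootFAux ε f g j` is `f_[j, j+g]`. -/
def rootFAux {A : Type*} [Ring A] [Algebra ℂ A] (ε : ℂ) (f : ℕ → A) : ℕ → ℕ → A
  | 0, j => f j
  | g + 1, j => ε • (rootFAux ε f g (j + 1) * f j) - f j * rootFAux ε f g (j + 1)

/-- The root vector `f_[j,k]` attached to the positive root `α_j + ⋯ + α_k`. -/
def rootF {A : Type*} [Ring A] [Algebra ℂ A] (ε : ℂ) (f : ℕ → A) (j k : ℕ) : A :=
  rootFAux ε f (k - j) j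

section AlgebraIdentities

variable {A : Type*} [Ring A] [Algebra ℂ A] {ε : ℂ}

/-- The quantum Serre relation between `b` and `x`, with denominators cleared. -/
def QuantumSerre (ε : ℂ) (b x : A) : Prop :=
  ε • (b * (b * x)) + ε • (x * (b * b)) = (ε ^ 2 + 1) • (b * (x * b))

theorem quantumSerre_of_sq (hε : ε ≠ 0) {b x : A}
    (h : b ^ 2 * x - (ε + ε⁻¹) • (b * x * b) + x * b ^ 2 = 0) : QuantumSerre ε b x := by
  have hc : ε * (ε + ε⁻¹) = ε ^ 2 + 1 := by field_simp
  have h' := congrArg (fun y => ε • y) h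
  simp only [smul_add, smul_sub, smul_smul, hc, pow_two b, mul_assoc, smul_zero] at h'
  unfold QuantumSerre
  linear_combination (norm := module) h'

theorem QuantumSerre.qcommutator_right {a b z : A} (h : QuantumSerre ε a b) (haz : Commute a z) :
    QuantumSerre ε a (ε • (z * b) - b * z) := by
  have haz' : a * z = z * a := haz
  have haz_left (t : A) : a * (z * t) = z * (a * t) := haz.left_comm t
  unfold QuantumSerre at *
  have h1 := congrArg (fun y => z * y) h
  have h2 := congrArg (fun y => y * z) h
  simp only [mul_sub, sub_mul, mul_add, add_mul, smul_mul_assoc, mul_smul_comm, mul_assoc,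
    haz_left, haz'] at h1 h2 ⊢
  linear_combination (norm := module) ε • h1 - h2

theorem QuantumSerre.smul_mul_qcommutator {a x : A} (h : QuantumSerre ε a x) :
    ε • (a * (ε • (x * a) - a * x)) = (ε • (x * a) - a * x) * a := by
  unfold QuantumSerre at h
  simp only [mul_sub, sub_mul, smul_mul_assoc, mul_smul_comm, mul_assoc]
  linear_combination (norm := module) -h

theorem QuantumSerre.smul_qcommutator_mul {a x : A} (h : QuantumSerre ε x a) :
    ε • ((ε • (x * a) - a * x) * x) = x * (ε • (x * a) - a * x) := by
  unfold QuantumSerre at h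
  simp only [mul_sub, sub_mul, smul_mul_assoc, mul_smul_comm, mul_assoc]
  linear_combination (norm := module) -h

theorem QuantumSerre.commute_qcommutator {a b z : A} (hε : 1 + ε ^ 2 ≠ 0)
    (ha : QuantumSerre ε b a) (hz : QuantumSerre ε b z) (haz : Commute a z) :
    Commute b (ε • ((ε • (z * b) - b * z) * a) - a * (ε • (z * b) - b * z)) := by
  have haz' : a * z = z * a := haz
  have haz_left (t : A) : a * (z * t) = z * (a * t) := haz.left_comm t
  unfold QuantumSerre at *
  have z1 := congrArg (fun y => y * a) hz
  have z2 := congrArg (fun y => z * y) ha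
  have a1 := congrArg (fun y => y * z) ha
  have a2 := congrArg (fun y => a * y) hz
  refine sub_eq_zero.mp ((smul_eq_zero_iff_right hε).mp ?_)
  simp only [mul_sub, sub_mul, mul_add, add_mul, smul_mul_assoc, mul_smul_comm, mul_assoc,
    haz_left, haz'] at z1 z2 a1 a2 ⊢
  linear_combination (norm := module) ε ^ 2 • (z2 - z1) + a2 - a1

theorem smul_qcommutator_mul_of_commute {a b y z : A} (hy : ε • (y * z) = z * y)
    (haz : Commute a z) (hyd : y = ε • (z * b) - b * z)
    (hb : Commute b (ε • (y * a) - a * y)) :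
    ε • ((ε • (y * a) - a * y) * y) = y * (ε • (y * a) - a * y) := by
  have hx : ε • ((ε • (y * a) - a * y) * z) = z * (ε • (y * a) - a * y) := by
    have h1 := congrArg (fun t => t * a) hy
    have h2 := congrArg (fun t => a * t) hy
    have haz' : a * z = z * a := haz
    have haz_left (t : A) : a * (z * t) = z * (a * t) := haz.left_comm t
    simp only [mul_sub, sub_mul, smul_mul_assoc, mul_smul_comm, mul_assoc, haz_left, haz'] at h1 h2 ⊢
    linear_combination (norm := module) ε • h1 - h2
  generalize ε • (y * a) - a * y = x at hx hb ⊢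
  have hb' : x * b = b * x := hb.eq.symm
  have h1 := congrArg (fun t => t * b) hx
  have h2 := congrArg (fun t => b * t) hx
  subst hyd
  simp only [mul_sub, sub_mul, smul_mul_assoc, mul_smul_comm, mul_assoc, smul_sub, hb'] at h1 h2 ⊢
  have h3 : x * (b * z) = b * (x * z) := by rw [← mul_assoc, hb', mul_assoc]
  rw [h3]
  linear_combination (norm := module) ε • h1 - h2

end AlgebraIdentities

section RootVectors

variable {A : Type*} [Ring A] [Algebra ℂ A] {ε : ℂ} {f : ℕ → A}

theorem rootF_self (j : ℕ) : rootF ε f j j = f j := by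
  simp [rootF, rootFAux]

theorem rootF_of_lt {j k : ℕ} (h : j < k) :
    rootF ε f j k = ε • (rootF ε f (j + 1) k * f j) - f j * rootF ε f (j + 1) k := by
  obtain ⟨g, rfl⟩ := Nat.exists_eq_add_of_lt h
  rw [rootF, rootF, show j + g + 1 - j = g + 1 by omega, show j + g + 1 - (j + 1) = g by omega]
  rfl

theorem Commute.rootF_right {x : A} {j k : ℕ} (hjk : j ≤ k)
    (h : ∀ m, j ≤ m → m ≤ k → Commute x (f m)) : Commute x (rootF ε f j k) := by
  induction hjk using Nat.decreasingInduction with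
  | self => rw [rootF_self]; exact h k le_rfl le_rfl
  | of_succ j hj ih =>
    have hx := ih fun m h1 h2 => h m (by omega) h2
    have hf := h j le_rfl hj.le
    rw [rootF_of_lt hj]
    exact ((hx.mul_right hf).smul_right ε).sub_right (hf.mul_right hx)

theorem quantumSerre_rootF {n : ℕ}
    (hfar : ∀ i j, 1 ≤ i → i + 2 ≤ j → j ≤ n → Commute (f i) (f j))
    (hserre : ∀ j, 1 ≤ j → j < n → QuantumSerre ε (f j) (f (j + 1)))
    {j k : ℕ} (hj : 1 ≤ j) (hjk : j < k) (hk : k ≤ n) :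
    QuantumSerre ε (f j) (rootF ε f (j + 1) k) := by
  rcases (Nat.succ_le_of_lt hjk).eq_or_lt with rfl | h
  · rw [rootF_self]
    exact hserre j hj (by omega)
  · rw [rootF_of_lt h]
    exact (hserre j hj (by omega)).qcommutator_right
      (Commute.rootF_right h fun m h1 h2 => hfar j m hj (by omega) (by omega))

theorem commute_rootF_of_lt_of_lt {n : ℕ} (hε : 1 + ε ^ 2 ≠ 0)
    (hfar : ∀ i j, 1 ≤ i → i + 2 ≤ j → j ≤ n → Commute (f i) (f j))
    (hserre : ∀ j, 1 ≤ j → j < n → QuantumSerre ε (f j) (f (j + 1)))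
    (hserre' : ∀ j, 1 ≤ j → j < n → QuantumSerre ε (f (j + 1)) (f j))
    {i j k : ℕ} (hj : 1 ≤ j) (hji : j + 1 ≤ i) (hik : i < k) (hk : k ≤ n) :
    Commute (f i) (rootF ε f j k) := by
  obtain ⟨i, rfl⟩ : ∃ i', i = i' + 1 := ⟨i - 1, by omega⟩
  induction (Nat.le_of_succ_le_succ hji) using Nat.decreasingInduction with
  | self =>
    rw [rootF_of_lt (by omega : i < k), rootF_of_lt hik]
    exact (hserre' i hj (by omega)).commute_qcommutator hε
      (quantumSerre_rootF hfar hserre (by omega) hik hk)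
      (Commute.rootF_right hik fun m h1 h2 => hfar i m hj (by omega) (by omega))
  | of_succ j hlt ih =>
    have hx := ih (by omega) (by omega)
    have hf := (hfar j (i + 1) hj (by omega) (by omega)).symm
    rw [rootF_of_lt (by omega : j < k)]
    exact ((hx.mul_right hf).smul_right ε).sub_right (hf.mul_right hx)

theorem smul_rootF_mul_rootF_succ {n : ℕ} (hε : 1 + ε ^ 2 ≠ 0)
    (hfar : ∀ i j, 1 ≤ i → i + 2 ≤ j → j ≤ n → Commute (f i) (f j))
    (hserre : ∀ j, 1 ≤ j → j < n → QuantumSerre ε (f j) (f (j + 1)))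
    (hserre' : ∀ j, 1 ≤ j → j < n → QuantumSerre ε (f (j + 1)) (f j))
    {j k : ℕ} (hj : 1 ≤ j) (hjk : j + 1 ≤ k) (hk : k ≤ n) :
    ε • (rootF ε f j k * rootF ε f (j + 1) k) = rootF ε f (j + 1) k * rootF ε f j k := by
  obtain ⟨k, rfl⟩ : ∃ k', k = k' + 1 := ⟨k - 1, by omega⟩
  induction (Nat.le_of_succ_le_succ hjk) using Nat.decreasingInduction with
  | self =>
    rw [rootF_of_lt (Nat.lt_succ_self k), rootF_self]
    exact (hserre' k hj (by omega)).smul_qcommutator_mul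
  | of_succ j hlt ih =>
    have hc := commute_rootF_of_lt_of_lt hε hfar hserre hserre' hj le_rfl
      (by omega : j + 1 < k + 1) hk
    rw [rootF_of_lt (by omega : j < k + 1)] at hc ⊢
    exact smul_qcommutator_mul_of_commute (ih (by omega) (by omega))
      (Commute.rootF_right (by omega) fun m h1 h2 => hfar j m hj (by omega) (by omega))
      (rootF_of_lt (by omega)) hc

end RootVectors

theorem rootF_commutation_relations {A : Type*} [Ring A] [Algebra ℂ A]
    (l n : ℕ) (hlodd : Odd l) (hl : 1 < l) (ε : ℂ) (hε : IsPrimitiveRoot ε l) (hn : 1 ≤ n)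
    (f : ℕ → A)
    -- quantum Serre relations
    (hfar : ∀ i j, 1 ≤ i → i ≤ n → 1 ≤ j → j ≤ n → (i + 2 ≤ j ∨ j + 2 ≤ i) →
      f i * f j = f j * f i)
    (hserre : ∀ i j, 1 ≤ i → i ≤ n → 1 ≤ j → j ≤ n → (j = i + 1 ∨ i = j + 1) →
      f i ^ 2 * f j - (ε + ε⁻¹) • (f i * f j * f i) + f j * f i ^ 2 = 0) :
    -- (i)
    (∀ i j k, 1 ≤ j → j ≤ k → k ≤ n → 1 ≤ i → (i + 2 ≤ j ∨ (j < i ∧ i < k)) →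
      f i * rootF ε f j k = rootF ε f j k * f i) ∧
    -- (ii)
    (∀ j k, 2 ≤ j → j ≤ k → k ≤ n →
      ε • (f (j - 1) * rootF ε f (j - 1) k) = rootF ε f (j - 1) k * f (j - 1)) ∧
    -- (iii)
    (∀ j k, 2 ≤ j → j ≤ k → k ≤ n →
      ε • (rootF ε f (j - 1) k * rootF ε f j k) = rootF ε f j k * rootF ε f (j - 1) k) := by
  have hε0 : ε ≠ 0 := hε.ne_zero (by omega)
  have hε2 : 1 + ε ^ 2 ≠ 0 := by
    intro h
    have h4 : ε ^ 4 = 1 := by linear_combination (ε ^ 2 - 1) * h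
    have hcop : Nat.Coprime l 4 := hlodd.coprime_two_right.pow_right 2
    have := hcop.eq_one_of_dvd (hε.dvd_of_pow_eq_one 4 h4)
    omega
  have far : ∀ i j, 1 ≤ i → i + 2 ≤ j → j ≤ n → Commute (f i) (f j) := fun i j hi hij hj =>
    hfar i j hi (by omega) (by omega) hj (Or.inl hij)
  have serre : ∀ j, 1 ≤ j → j < n → QuantumSerre ε (f j) (f (j + 1)) := fun j h1 h2 =>
    quantumSerre_of_sq hε0 (hserre j (j + 1) h1 h2.le (by omega) h2 (Or.inl rfl))
  have serre' : ∀ j, 1 ≤ j → j < n → QuantumSerre ε (f (j + 1)) (f j) := fun j h1 h2 =>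
    quantumSerre_of_sq hε0 (hserre (j + 1) j (by omega) h2 h1 h2.le (Or.inr rfl))
  refine ⟨fun i j k hj hjk hk hi hij => ?_, fun j k hj hjk hk => ?_, fun j k hj hjk hk => ?_⟩
  · rcases hij with hij | ⟨hji, hik⟩
    · exact Commute.rootF_right hjk fun m h1 h2 => far i m hi (by omega) (by omega)
    · exact commute_rootF_of_lt_of_lt hε2 far serre serre' hj hji hik hk
  · obtain ⟨j, rfl⟩ : ∃ j', j = j' + 1 := ⟨j - 1, by omega⟩
    rw [Nat.add_sub_cancel, rootF_of_lt hjk]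
    exact (quantumSerre_rootF far serre (by omega) hjk hk).smul_mul_qcommutator
  · obtain ⟨j, rfl⟩ : ∃ j', j = j' + 1 := ⟨j - 1, by omega⟩
    exact smul_rootF_mul_rootF_succ hε2 far serre serre' (by omega) hjk hk
end
end

section
/- For all 1 ≤ i ≤ j < k ≤ n one has in A: e_{[j+1,k]} e_{[i,j]} − ε e_{[i,j]} e_{[j+1,k]} = ε e_{[i,k]}. (Consequently the alternative root vector of Date–Jimbo–Miki–Miwa, defined from any splitting of the root α_i+···+α_k into two consecutive segments, is independent of the splitting and equals ε^{k−i} e_{[i,k]}, i.e. ε^{height−1} times e_{[i,k]}.) -/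
noncomputable section

/-- Auxiliary recursive definition of the positive root vectors:
`rootEAux ε e g j` is `e_[j, j+g]`. -/
def rootEAux {A : Type*} [Ring A] [Algebra ℂ A] (ε : ℂ) (e : ℕ → A) : ℕ → ℕ → A
  | 0, j => e j
  | g + 1, j => ε⁻¹ • (rootEAux ε e g (j + 1) * e j) - e j * rootEAux ε e g (j + 1)

/-- The root vector `e_[j,k]` attached to the positive root `α_j + ⋯ + α_k`. -/
def rootE {A : Type*} [Ring A] [Algebra ℂ A] (ε : ℂ) (e : ℕ → A) (j k : ℕ) : A :=
  rootEAux ε e (k - j) j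

section RootVectors

variable {A : Type*} [Ring A] [Algebra ℂ A]

theorem rootE_self (ε : ℂ) (e : ℕ → A) (j : ℕ) : rootE ε e j j = e j := by
  simp [rootE, rootEAux]

theorem rootE_of_lt (ε : ℂ) (e : ℕ → A) {j k : ℕ} (h : j < k) :
    rootE ε e j k = ε⁻¹ • (rootE ε e (j + 1) k * e j) - e j * rootE ε e (j + 1) k := by
  obtain ⟨g, hg⟩ : ∃ g, k - j = g + 1 := ⟨k - j - 1, by omega⟩
  have hg' : k - (j + 1) = g := by omega
  simp only [rootE, hg, hg', rootEAux]

/-- An element commuting with the generators of a segment commutes with its root vector. -/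
theorem commute_rootE (ε : ℂ) (e : ℕ → A) {a : A} {j k : ℕ} (hjk : j ≤ k)
    (h : ∀ m, j ≤ m → m ≤ k → Commute a (e m)) : Commute a (rootE ε e j k) := by
  induction hjk using Nat.decreasingInduction with
  | self => simpa only [rootE_self] using h k le_rfl le_rfl
  | of_succ j hj ih =>
    have hr := ih fun m hm hmk => h m (by omega) hmk
    have hej := h j le_rfl hj.le
    rw [rootE_of_lt ε e hj]
    exact ((hr.mul_right hej).smul_right _).sub_right (hej.mul_right hr)

/-- If `x` commutes with `a`, taking the `ε`-commutator with `x` commutes with the operation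
`y ↦ ε⁻¹ • (y * a) - a * y`. -/
theorem qCommutator_step {ε : ℂ} (hε : ε ≠ 0) {x y z a : A} (hxa : Commute x a)
    (h : x * y - ε • (y * x) = ε • z) :
    x * (ε⁻¹ • (y * a) - a * y) - ε • ((ε⁻¹ • (y * a) - a * y) * x) =
      ε • (ε⁻¹ • (z * a) - a * z) := by
  have hz : z = ε⁻¹ • (x * y) - y * x := by
    rw [← inv_smul_smul₀ hε z, ← h, smul_sub, inv_smul_smul₀ hε]
  have h₁ : y * a * x = y * x * a := by rw [mul_assoc, ← hxa.eq, mul_assoc]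
  have h₂ : x * (a * y) = a * (x * y) := by rw [← mul_assoc, hxa.eq, mul_assoc]
  subst hz
  simp only [mul_sub, sub_mul, smul_sub, mul_smul_comm, smul_mul_assoc, smul_inv_smul₀ hε,
    h₁, h₂, mul_assoc]
  abel

end RootVectors

theorem rootE_splitting {A : Type*} [Ring A] [Algebra ℂ A]
    (l n : ℕ) (hlodd : Odd l) (hl : 1 < l) (ε : ℂ) (hε : IsPrimitiveRoot ε l) (hn : 1 ≤ n)
    (e : ℕ → A)
    -- quantum Serre relations
    (hfar : ∀ i j, 1 ≤ i → i ≤ n → 1 ≤ j → j ≤ n → (i + 2 ≤ j ∨ j + 2 ≤ i) →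
      e i * e j = e j * e i)
    (hserre : ∀ i j, 1 ≤ i → i ≤ n → 1 ≤ j → j ≤ n → (j = i + 1 ∨ i = j + 1) →
      e i ^ 2 * e j - (ε + ε⁻¹) • (e i * e j * e i) + e j * e i ^ 2 = 0) :
    ∀ i j k, 1 ≤ i → i ≤ j → j < k → k ≤ n →
      rootE ε e (j + 1) k * rootE ε e i j - ε • (rootE ε e i j * rootE ε e (j + 1) k) =
        ε • rootE ε e i k := by
  have hε0 : ε ≠ 0 := hε.ne_zero (by omega)
  intro i j k hi hij hjk hkn
  induction hij using Nat.decreasingInduction with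
  | self =>
    rw [rootE_self, rootE_of_lt ε e hjk, smul_sub, smul_inv_smul₀ hε0]
  | of_succ i hij ih =>
    have hcomm : Commute (rootE ε e (j + 1) k) (e i) :=
      (commute_rootE ε e hjk fun m hm hmk =>
        hfar i m hi (by omega) (by omega) (by omega) (Or.inl (by omega))).symm
    rw [rootE_of_lt ε e hij, rootE_of_lt ε e (hij.trans hjk)]
    exact qCommutator_step hε0 hcomm (ih (by omega))
end
end

section
/- For all 1 ≤ i ≤ j < k ≤ n one has in A: f_{[j+1,k]} f_{[i,j]} − ε^{−1} f_{[i,j]} f_{[j+1,k]} = ε^{−1} f_{[i,k]}. (Consequently the alternative root vector of Date–Jimbo–Miki–Miwa, defined from any splitting of the root α_i+···+α_k into two consecutive segments, is independent of the splitting and equals ε^{−(k−i)} f_{[i,k]}, i.e. ε^{−(height−1)} times f_{[i,k]}.) -/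
noncomputable section

/-- An element commuting with `f m` for all `m ∈ [j, j+g]` commutes with `f_[j, j+g]`. -/
theorem commute_rootFAux {A : Type*} [Ring A] [Algebra ℂ A] (ε : ℂ) (f : ℕ → A) (x : A)
    (g j : ℕ) (hx : ∀ m, j ≤ m → m ≤ j + g → Commute x (f m)) :
    Commute x (rootFAux ε f g j) := by
  induction g generalizing j with
  | zero => exact hx j le_rfl le_rfl
  | succ g ih =>
    have hj := hx j le_rfl (by omega)
    have hg := ih (j + 1) fun m hm hm' => hx m (by omega) (by omega)
    exact ((hg.mul_right hj).smul_right ε).sub_right (hj.mul_right hg)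

/-- If `x` commutes with `F` and `H` is the `q`-commutator of `F` and `G`, then the
`q`-commutator of `F` with that of `G` and `x` is the one of `H` and `x`. -/
theorem qcommutator_of_commute {A : Type*} [Ring A] [Algebra ℂ A] {ε : ℂ} (hε : ε ≠ 0)
    {F G H x : A} (hx : Commute x F) (hFG : F * G - ε⁻¹ • (G * F) = ε⁻¹ • H) :
    F * (ε • (G * x) - x * G) - ε⁻¹ • ((ε • (G * x) - x * G) * F) =
      ε⁻¹ • (ε • (H * x) - x * H) := by
  have hGF : F * G = ε⁻¹ • (G * F) + ε⁻¹ • H := by rw [← hFG]; abel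
  have h₁ : F * (G * x) = ε⁻¹ • (G * F * x) + ε⁻¹ • (H * x) := by
    rw [← mul_assoc, hGF, add_mul, smul_mul_assoc, smul_mul_assoc]
  have h₂ : F * (x * G) = ε⁻¹ • (x * (G * F)) + ε⁻¹ • (x * H) := by
    rw [← mul_assoc, ← hx.eq, mul_assoc, hGF, mul_add, mul_smul_comm, mul_smul_comm]
  have h₃ : G * x * F = G * F * x := by rw [mul_assoc, hx.eq, mul_assoc]
  rw [mul_sub, mul_smul_comm, sub_mul, smul_mul_assoc, h₁, h₂, h₃, mul_assoc x G F]
  match_scalars <;> field_simp <;> ring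

/-- A root vector splits into two consecutive segments as soon as the generators
at distance at least two commute. -/
theorem rootFAux_splitting {A : Type*} [Ring A] [Algebra ℂ A] {ε : ℂ} (hε : ε ≠ 0)
    (f : ℕ → A) (a b i : ℕ)
    (hfar : ∀ s t, i ≤ s → s + 2 ≤ t → t ≤ i + a + b + 1 → Commute (f s) (f t)) :
    rootFAux ε f b (i + a + 1) * rootFAux ε f a i -
        ε⁻¹ • (rootFAux ε f a i * rootFAux ε f b (i + a + 1)) =
      ε⁻¹ • rootFAux ε f (a + b + 1) i := by
  induction a generalizing i with
  | zero =>
    simp only [Nat.zero_add, Nat.add_zero, rootFAux, smul_sub, smul_smul,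
      inv_mul_cancel₀ hε, one_smul]
  | succ a ih =>
    have hIH := ih (i + 1) fun s t hs hst ht => hfar s t (by omega) hst (by omega)
    have hcomm : Commute (f i) (rootFAux ε f b (i + (a + 1) + 1)) :=
      commute_rootFAux ε f (f i) b _ fun m hm hm' =>
        hfar i m le_rfl (by omega) (by omega)
    rw [show i + 1 + a + 1 = i + (a + 1) + 1 by omega] at hIH
    rw [show a + 1 + b + 1 = a + b + 1 + 1 by omega]
    exact qcommutator_of_commute hε hcomm hIH

theorem rootF_splitting {A : Type*} [Ring A] [Algebra ℂ A]
    (l n : ℕ) (hlodd : Odd l) (hl : 1 < l) (ε : ℂ) (hε : IsPrimitiveRoot ε l) (hn : 1 ≤ n)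
    (f : ℕ → A)
    -- quantum Serre relations
    (hfar : ∀ i j, 1 ≤ i → i ≤ n → 1 ≤ j → j ≤ n → (i + 2 ≤ j ∨ j + 2 ≤ i) →
      f i * f j = f j * f i)
    (hserre : ∀ i j, 1 ≤ i → i ≤ n → 1 ≤ j → j ≤ n → (j = i + 1 ∨ i = j + 1) →
      f i ^ 2 * f j - (ε + ε⁻¹) • (f i * f j * f i) + f j * f i ^ 2 = 0) :
    ∀ i j k, 1 ≤ i → i ≤ j → j < k → k ≤ n →
      rootF ε f (j + 1) k * rootF ε f i j - ε⁻¹ • (rootF ε f i j * rootF ε f (j + 1) k) =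
        ε⁻¹ • rootF ε f i k := by
  intro i j k hi hij hjk hk
  have hε0 : ε ≠ 0 := hε.ne_zero (by omega)
  obtain ⟨a, rfl⟩ := Nat.exists_eq_add_of_le hij
  obtain ⟨b, rfl⟩ := Nat.exists_eq_add_of_le (Nat.succ_le_of_lt hjk)
  have h := rootFAux_splitting hε0 f a b i fun s t hs hst ht =>
    hfar s t (by omega) (by omega) (by omega) (by omega) (Or.inl hst)
  simpa only [rootF, Nat.succ_eq_add_one, Nat.add_sub_cancel_left,
    show i + a + 1 + b - i = a + b + 1 by omega] using h
end
end

section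
/- For all 1 ≤ j ≤ k ≤ n the root-vector operators on 𝒱 satisfy E_{[j,k]}^l = 0 and F_{[j,k]}^l = 0, and for all 1 ≤ i ≤ n one has T_i^{2l} = id. -/
noncomputable section

/-- The index set `M` of tuples `m = (m_{jk})_{1 ≤ j ≤ k ≤ n}` with entries in `ℤ/lℤ`. -/
abbrev Mt (l n : ℕ) := {p : ℕ × ℕ // 1 ≤ p.1 ∧ p.1 ≤ p.2 ∧ p.2 ≤ n} → ZMod l

/-- The vector space `𝒱` with basis `(u_m)_{m ∈ M}`. -/
abbrev Vsp (l n : ℕ) := Mt l n →₀ ℂ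

/-- The basis vector `u_m` of `𝒱`. -/
def um {l n : ℕ} (m : Mt l n) : Vsp l n := Finsupp.single m 1

/-- The tuple `δ_{jk}` with `(j,k)`-entry `1` and all other entries `0`
(it is `0` if `(j,k)` is out of range). -/
def dlt {l n : ℕ} (j k : ℕ) : Mt l n := fun p => if p.val = (j, k) then 1 else 0

/-- The `(j,k)`-entry of `m`, read as `0` outside the range `1 ≤ j ≤ k ≤ n`. -/
def mval {l n : ℕ} (m : Mt l n) (j k : ℕ) : ZMod l :=
  if h : 1 ≤ j ∧ j ≤ k ∧ k ≤ n then m ⟨(j, k), h⟩ else 0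

/-- The shift operator `u_m ↦ u_{m + ξ}` on `𝒱`. -/
def shiftOp {l n : ℕ} (ξ : Mt l n) : Module.End ℂ (Vsp l n) :=
  Finsupp.lmapDomain ℂ ℂ (fun m => m + ξ)

/-- The diagonal operator `u_m ↦ f(m) • u_m` on `𝒱`. -/
def diagOp {l n : ℕ} (f : Mt l n → ℂ) : Module.End ℂ (Vsp l n) :=
  Finsupp.lsum ℂ (fun m => f m • Finsupp.lsingle m)

/-- `ε^a` for `a ∈ ℤ/lℤ`, well defined via the canonical representative since `ε^l = 1`. -/
def epow {l : ℕ} (ε : ℂ) (a : ZMod l) : ℂ := ε ^ a.val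

/-- The operator `X_{jk} : u_m ↦ ε^{m_{jk}} u_m` (the identity for out-of-range `(j,k)`). -/
def Xop (l n : ℕ) (ε : ℂ) (j k : ℕ) : Module.End ℂ (Vsp l n) :=
  diagOp (fun m => epow ε (mval m j k))

/-- The inverse operator `X_{jk}⁻¹ : u_m ↦ ε^{-m_{jk}} u_m`. -/
def XopInv (l n : ℕ) (ε : ℂ) (j k : ℕ) : Module.End ℂ (Vsp l n) :=
  diagOp (fun m => (epow ε (mval m j k))⁻¹)

/-- `{c W} = (cW - c⁻¹W⁻¹)/(ε - ε⁻¹)` for the invertible shift operator `W = shiftOp ζ`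
(whose inverse is `shiftOp (-ζ)`). -/
def braceShift (l n : ℕ) (ε c : ℂ) (ζ : Mt l n) : Module.End ℂ (Vsp l n) :=
  (ε - ε⁻¹)⁻¹ • (c • shiftOp ζ - c⁻¹ • shiftOp (-ζ))

/-- The total shift of `Z_{ik} Z_{i,k-1} Z_{i-1,k-1}⁻¹ Z_{i+1,k}⁻¹`. -/
def zetaE (l n : ℕ) (i k : ℕ) : Mt l n :=
  dlt i k + dlt i (k - 1) - dlt (i - 1) (k - 1) - dlt (i + 1) k

/-- The total shift of
`Z_{i+1-k,n-k} Z_{i+1-k,n+1-k}⁻¹ Z_{i-k,n+1-k} Z_{i-k,n-k}⁻¹`. -/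
def zetaF (l n : ℕ) (i k : ℕ) : Mt l n :=
  dlt (i + 1 - k) (n - k) - dlt (i + 1 - k) (n + 1 - k) +
    dlt (i - k) (n + 1 - k) - dlt (i - k) (n - k)

/-- The total shift of `Z_{in}² Z_{i-1,n}⁻¹ Z_{i+1,n}⁻¹`. -/
def zetaT (l n : ℕ) (i : ℕ) : Mt l n :=
  dlt i n + dlt i n - dlt (i - 1) n - dlt (i + 1) n

/-- The product `X_{ik} X_{i,k+1} ⋯ X_{in}`. -/
def XprodE (l n : ℕ) (ε : ℂ) (i k : ℕ) : Module.End ℂ (Vsp l n) :=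
  (List.ofFn (fun t : Fin (n + 1 - k) => Xop l n ε i (k + (t : ℕ)))).prod

/-- The product `X_{i+1-k,n+1-k}⁻¹ X_{i+2-k,n+2-k}⁻¹ ⋯ X_{i,n}⁻¹`. -/
def XprodF (l n : ℕ) (ε : ℂ) (i k : ℕ) : Module.End ℂ (Vsp l n) :=
  (List.ofFn (fun t : Fin k =>
    XopInv l n ε (i + 1 - k + (t : ℕ)) (n + 1 - k + (t : ℕ)))).prod

/-- The representation operator `Φ_{r,s,a,b}(e_i)`. -/
def PhiE (l n : ℕ) (ε : ℂ) (r : ℕ → ℂ) (a b : ℕ → ℕ → ℂ) (i : ℕ) :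
    Module.End ℂ (Vsp l n) :=
  ∑ k ∈ Finset.Icc i n,
    (∏ t ∈ Finset.range (n + 1 - k), a i (k + t)) •
      (XprodE l n ε i k *
        braceShift l n ε
          (r i * (b i k * b i (k - 1) * (b (i - 1) (k - 1))⁻¹ * (b (i + 1) k)⁻¹))
          (zetaE l n i k))

/-- The representation operator `Φ_{r,s,a,b}(f_i)`. -/
def PhiF (l n : ℕ) (ε : ℂ) (s : ℕ → ℂ) (a b : ℕ → ℕ → ℂ) (i : ℕ) :
    Module.End ℂ (Vsp l n) :=
  ∑ k ∈ Finset.Icc 1 i,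
    (∏ t ∈ Finset.range k, a (i + 1 - k + t) (n + 1 - k + t))⁻¹ •
      (XprodF l n ε i k *
        braceShift l n ε
          (s i * (b (i + 1 - k) (n - k) * (b (i + 1 - k) (n + 1 - k))⁻¹ *
            b (i - k) (n + 1 - k) * (b (i - k) (n - k))⁻¹))
          (zetaF l n i k))

/-- The representation operator `Φ_{r,s,a,b}(t_i)`. -/
def PhiT (l n : ℕ) (ε : ℂ) (r s : ℕ → ℂ) (b : ℕ → ℕ → ℂ) (i : ℕ) :
    Module.End ℂ (Vsp l n) :=
  ((r i / s i) * (b i n ^ 2 * (b (i - 1) n)⁻¹ * (b (i + 1) n)⁻¹)) • shiftOp (zetaT l n i)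

/-- The specialized operator `E_i = Σ_{k=i}^n X_{ik}⋯X_{in} {Z_{ik}Z_{i,k-1}Z_{i-1,k-1}⁻¹Z_{i+1,k}⁻¹}`. -/
def Esp (l n : ℕ) (ε : ℂ) (i : ℕ) : Module.End ℂ (Vsp l n) :=
  ∑ k ∈ Finset.Icc i n, XprodE l n ε i k * braceShift l n ε 1 (zetaE l n i k)

/-- The specialized operator
`F_i = Σ_{k=1}^i X_{i+1-k,n+1-k}⁻¹⋯X_{i,n}⁻¹ {ε^{-λ_i} Z_{i+1-k,n-k}Z_{i+1-k,n+1-k}⁻¹Z_{i-k,n+1-k}Z_{i-k,n-k}⁻¹}`. -/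
def Fsp (l n : ℕ) (ε : ℂ) (lam : ℕ → ℕ) (i : ℕ) : Module.End ℂ (Vsp l n) :=
  ∑ k ∈ Finset.Icc 1 i, XprodF l n ε i k * braceShift l n ε ((ε ^ lam i)⁻¹) (zetaF l n i k)

/-- The specialized operator `T_i = ε^{λ_i} Z_{in}² Z_{i-1,n}⁻¹ Z_{i+1,n}⁻¹`. -/
def Tsp (l n : ℕ) (ε : ℂ) (lam : ℕ → ℕ) (i : ℕ) : Module.End ℂ (Vsp l n) :=
  (ε ^ lam i) • shiftOp (zetaT l n i)

/-- The inverse operator `T_i⁻¹`. -/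
def TspInv (l n : ℕ) (ε : ℂ) (lam : ℕ → ℕ) (i : ℕ) : Module.End ℂ (Vsp l n) :=
  (ε ^ lam i)⁻¹ • shiftOp (-(zetaT l n i))

/-- Auxiliary recursive definition of the positive root-vector operators:
`ErootAux l n ε lam g j` is `E_[j, j+g]`. -/
def ErootAux (l n : ℕ) (ε : ℂ) : ℕ → ℕ → Module.End ℂ (Vsp l n)
  | 0, j => Esp l n ε j
  | g + 1, j =>
      ε⁻¹ • (ErootAux l n ε g (j + 1) * Esp l n ε j) - Esp l n ε j * ErootAux l n ε g (j + 1)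

/-- The root-vector operator `E_[j,k]`. -/
def Eroot (l n : ℕ) (ε : ℂ) (j k : ℕ) : Module.End ℂ (Vsp l n) :=
  ErootAux l n ε (k - j) j

/-- Auxiliary recursive definition of the negative root-vector operators:
`FrootAux l n ε lam g j` is `F_[j, j+g]`. -/
def FrootAux (l n : ℕ) (ε : ℂ) (lam : ℕ → ℕ) : ℕ → ℕ → Module.End ℂ (Vsp l n)
  | 0, j => Fsp l n ε lam j
  | g + 1, j =>
      ε • (FrootAux l n ε lam g (j + 1) * Fsp l n ε lam j) -
        Fsp l n ε lam j * FrootAux l n ε lam g (j + 1)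

/-- The root-vector operator `F_[j,k]`. -/
def Froot (l n : ℕ) (ε : ℂ) (lam : ℕ → ℕ) (j k : ℕ) : Module.End ℂ (Vsp l n) :=
  FrootAux l n ε lam (k - j) j

section QCommute

variable {K R : Type*} [Field K] [Ring R] [Algebra K R]

/-- The Gaussian binomial coefficient evaluated at `ω`. -/
def gaussChoose (ω : K) : ℕ → ℕ → K
  | _, 0 => 1
  | 0, _ + 1 => 0
  | m + 1, k + 1 => gaussChoose ω m k + ω ^ (k + 1) * gaussChoose ω m (k + 1)

theorem gaussChoose_zero_right (ω : K) (m : ℕ) : gaussChoose ω m 0 = 1 := by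
  cases m <;> rfl

theorem gaussChoose_succ_succ (ω : K) (m k : ℕ) : gaussChoose ω (m + 1) (k + 1) =
    gaussChoose ω m k + ω ^ (k + 1) * gaussChoose ω m (k + 1) := rfl

theorem gaussChoose_eq_zero_of_lt (ω : K) {m k : ℕ} (h : m < k) : gaussChoose ω m k = 0 := by
  induction m generalizing k with
  | zero => obtain ⟨k, rfl⟩ := Nat.exists_eq_succ_of_ne_zero h.ne'; rfl
  | succ m ih =>
    obtain ⟨k, rfl⟩ := Nat.exists_eq_succ_of_ne_zero (Nat.ne_zero_of_lt h)
    rw [Nat.succ_eq_add_one, gaussChoose_succ_succ, ih (by omega), ih (by omega)]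
    simp

theorem gaussChoose_self (ω : K) (m : ℕ) : gaussChoose ω m m = 1 := by
  induction m with
  | zero => rfl
  | succ m ih => rw [gaussChoose_succ_succ, ih, gaussChoose_eq_zero_of_lt ω m.lt_succ_self]; simp

theorem one_sub_pow_mul_gaussChoose (ω : K) (m k : ℕ) :
    (1 - ω ^ (k + 1)) * gaussChoose ω (m + 1) (k + 1) = (1 - ω ^ (m + 1)) * gaussChoose ω m k := by
  induction m generalizing k with
  | zero => cases k <;> simp [gaussChoose]
  | succ m ih =>
    have h1 := ih k
    rw [gaussChoose_succ_succ ω (m + 1) k]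
    cases k with
    | zero =>
      simp only [gaussChoose_zero_right] at h1 ⊢
      linear_combination ω * h1
    | succ k =>
      have h2 := ih k
      have h3 := gaussChoose_succ_succ ω m k
      linear_combination ω ^ (k + 1 + 1) * h1 - ω * (1 - ω ^ (m + 1)) * h3 + ω * h2

theorem pow_mul_of_mul_eq_smul {ω : K} {U V : R} (h : V * U = ω • (U * V)) (k : ℕ) :
    V * U ^ k = ω ^ k • (U ^ k * V) := by
  induction k with
  | zero => simp
  | succ k ih =>
    rw [pow_succ, ← mul_assoc, ih, smul_mul_assoc, mul_assoc, h, mul_smul_comm, smul_smul,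
      mul_assoc, pow_succ]

/-- The noncommutative `q`-binomial theorem. -/
theorem add_pow_of_mul_eq_smul {ω : K} {U V : R} (h : V * U = ω • (U * V)) (m : ℕ) :
    (U + V) ^ m = ∑ k ∈ Finset.range (m + 1), gaussChoose ω m k • (U ^ k * V ^ (m - k)) := by
  induction m with
  | zero => simp [gaussChoose]
  | succ m ih =>
    have hV : ∑ k ∈ Finset.range (m + 1), V * gaussChoose ω m k • (U ^ k * V ^ (m - k)) =
        V ^ (m + 1) + ∑ k ∈ Finset.range (m + 1),
          (ω ^ (k + 1) * gaussChoose ω m (k + 1)) • (U ^ (k + 1) * V ^ (m - k)) := by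
      have key : ∀ k ∈ Finset.range (m + 1), V * gaussChoose ω m k • (U ^ k * V ^ (m - k)) =
          (ω ^ k * gaussChoose ω m k) • (U ^ k * V ^ (m + 1 - k)) := by
        intro k hk
        rw [Finset.mem_range] at hk
        rw [mul_smul_comm, ← mul_assoc, pow_mul_of_mul_eq_smul h, smul_mul_assoc, smul_smul,
          mul_assoc, ← pow_succ', mul_comm, show m - k + 1 = m + 1 - k by omega]
      rw [Finset.sum_congr rfl key, Finset.sum_range_succ', Finset.sum_range_succ _ m,
        gaussChoose_eq_zero_of_lt ω m.lt_succ_self]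
      simp [gaussChoose_zero_right, add_comm]
    rw [pow_succ', ih, add_mul, Finset.mul_sum, Finset.mul_sum, hV,
      Finset.sum_range_succ' _ (m + 1)]
    simp only [gaussChoose_succ_succ, add_smul, Finset.sum_add_distrib, Nat.add_sub_add_right,
      mul_smul_comm, ← mul_assoc, ← pow_succ', gaussChoose_zero_right, pow_zero, one_mul, one_smul,
      Nat.sub_zero]
    abel

theorem add_pow_of_isPrimitiveRoot {ω : K} {l : ℕ} (hl : 0 < l) (hω : IsPrimitiveRoot ω l)
    {U V : R} (h : V * U = ω • (U * V)) : (U + V) ^ l = U ^ l + V ^ l := by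
  obtain ⟨m, rfl⟩ := Nat.exists_eq_succ_of_ne_zero hl.ne'
  have hz : ∀ k ∈ Finset.range m, gaussChoose ω (m + 1) (k + 1) = 0 := by
    intro k hk
    rw [Finset.mem_range] at hk
    have := one_sub_pow_mul_gaussChoose ω m k
    rw [hω.pow_eq_one, sub_self, zero_mul, mul_eq_zero] at this
    exact this.resolve_left (sub_ne_zero.2 (hω.pow_ne_one_of_pos_of_lt k.succ_ne_zero
      (by omega)).symm)
  rw [add_pow_of_mul_eq_smul h, Nat.succ_eq_add_one, Finset.sum_range_succ, Finset.sum_range_succ',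
    Finset.sum_eq_zero fun k hk => by rw [hz k hk, zero_smul], gaussChoose_zero_right,
    gaussChoose_self]
  simp [add_comm]

theorem mul_pow_of_mul_eq_smul {r : K} {x y : R} (h : y * x = r • (x * y)) (m : ℕ) :
    (x * y) ^ m = r ^ m.choose 2 • (x ^ m * y ^ m) := by
  induction m with
  | zero => simp
  | succ m ih =>
    have h' : y ^ m * x = r ^ m • (x * y ^ m) := by
      clear ih
      induction m with
      | zero => simp
      | succ m ih =>
        rw [pow_succ, mul_assoc, h, mul_smul_comm, ← mul_assoc, ih, smul_mul_assoc, smul_smul,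
          mul_assoc, pow_succ' r]
    have hc : (m + 1).choose 2 = m.choose 2 + m := by
      rw [Nat.choose_succ_succ' m 1, Nat.choose_one_right, add_comm]
    rw [pow_succ, ih, smul_mul_assoc, mul_assoc, ← mul_assoc (y ^ m), h', hc, pow_add, mul_smul,
      smul_mul_assoc, mul_smul_comm, pow_succ, pow_succ]
    simp only [mul_assoc]

theorem pow_choose_two_eq_one {r : K} {l : ℕ} (hl : Odd l) (hr : r ^ l = 1) :
    r ^ l.choose 2 = 1 := by
  obtain ⟨t, rfl⟩ := hl
  rw [Nat.choose_two_right, Nat.add_sub_cancel, mul_left_comm, Nat.mul_div_cancel_left _ two_pos,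
    pow_mul, hr, one_pow]

end QCommute

section ChainSum

/-- The Cartan matrix of type `A`. -/
def cartanA (i j : ℕ) : ℤ := if i = j then 2 else if i = j + 1 ∨ j = i + 1 then -1 else 0

/-- The pairing of the root `α_a + ⋯ + α_b` with the simple root `α_i`. -/
def rootPairing (b a i : ℕ) : ℤ :=
  (if a ≤ i ∧ i ≤ b then 2 else 0) - (if a ≤ i + 1 ∧ i + 1 ≤ b then 1 else 0) -
    (if a + 1 ≤ i ∧ i ≤ b + 1 then 1 else 0)

theorem rootPairing_eq_add {b a : ℕ} (i : ℕ) (h : a ≤ b) :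
    rootPairing b a i = cartanA a i + rootPairing b (a + 1) i := by
  unfold rootPairing cartanA
  split_ifs <;> omega

theorem rootPairing_succ (b i : ℕ) : rootPairing b (b + 1) i = 0 := by
  unfold rootPairing
  split_ifs <;> omega

/-- Applying the elementary unipotent transformations `f ↦ f + f(c z + 1) y_z · δ_{c z}` for `z`
running through a list, from right to left. -/
def unipotentFold {α R : Type*} [Ring R] (c : α → ℕ) (y : α → R) (f : ℕ → R) : List α → ℕ → R
  | [], a => f a
  | z :: L, a => unipotentFold c y f L a +
      if c z = a then unipotentFold c y f L (a + 1) * y z else 0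

theorem unipotentFold_append {α R : Type*} [Ring R] (c : α → ℕ) (y : α → R) (f : ℕ → R)
    (L L' : List α) :
    unipotentFold c y f (L ++ L') = unipotentFold c y (unipotentFold c y f L') L := by
  induction L with
  | nil => rfl
  | cons z L ih => funext a; simp only [List.cons_append, unipotentFold, ih]

theorem unipotentFold_palindrome {α R : Type*} [Ring R] (c : α × Bool → ℕ) (y : α × Bool → R)
    (hc : ∀ p, c (p, true) = c (p, false)) (hy : ∀ p, y (p, true) = - y (p, false))
    (W : List α) (f : ℕ → R) :
    unipotentFold c y f (W.map (·, true) ++ (W.map (·, false)).reverse) = f := by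
  induction W generalizing f with
  | nil => rfl
  | cons w W ih =>
    rw [List.map_cons, List.map_cons, List.reverse_cons, List.cons_append, ← List.append_assoc]
    funext a
    simp only [unipotentFold, unipotentFold_append _ _ _ _ [(w, false)], ih, hc, hy]
    split_ifs with h1 h2
    · omega
    · simp
    · simp

/-- The sum of `y_{p_b} ⋯ y_{p_a}` over the chains of positions `p_a < ⋯ < p_b` of the list
with `p_i` of colour `i`. -/
abbrev chainSum {α R : Type*} [Ring R] (c : α → ℕ) (y : α → R) (b : ℕ) (L : List α) (a : ℕ) : R :=
  unipotentFold c y (fun a => if a = b + 1 then 1 else 0) L a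

/-- The sum of the elements of a given colour. -/
def colourSum {α R : Type*} [Ring R] (c : α → ℕ) (y : α → R) (L : List α) (i : ℕ) : R :=
  (L.map fun z => if c z = i then y z else 0).sum

variable {K R α : Type*} [Field K] [Ring R] [Algebra K R] {c : α → ℕ} {y : α → R} {b : ℕ}

theorem chainSum_eq_zero (L : List α) {a : ℕ} (h : b + 1 < a) : chainSum c y b L a = 0 := by
  induction L generalizing a with
  | nil => simp [unipotentFold, h.ne']
  | cons z L ih => simp [unipotentFold, ih h, ih (h.trans a.lt_succ_self)]

theorem chainSum_succ (L : List α) : chainSum c y b L (b + 1) = 1 := by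
  induction L with
  | nil => simp [unipotentFold]
  | cons z L ih =>
    simp only [chainSum, unipotentFold] at ih ⊢
    rw [ih]
    have := chainSum_eq_zero (c := c) (y := y) (b := b) L (b + 1).lt_succ_self
    simp only [chainSum, Nat.succ_eq_add_one] at this
    simp [this]

theorem chainSum_cons (z : α) (L : List α) (a : ℕ) : chainSum c y b (z :: L) a =
    chainSum c y b L a + if c z = a then chainSum c y b L (a + 1) * y z else 0 := rfl

theorem chainSum_self (L : List α) : chainSum c y b L b = colourSum c y L b := by
  induction L with
  | nil => simp [unipotentFold, colourSum]
  | cons z L ih =>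
    rw [chainSum_cons, ih, chainSum_succ]
    simp [colourSum, add_comm]

theorem chainSum_mul {q : K} (hq : q ≠ 0) {L : List α} {x : R} {i : ℕ}
    (hx : ∀ w ∈ L, y w * x = q ^ cartanA (c w) i • (x * y w)) (a : ℕ) :
    chainSum c y b L a * x = q ^ rootPairing b a i • (x * chainSum c y b L a) := by
  induction L generalizing a with
  | nil =>
    by_cases h : a = b + 1
    · subst h; simp [unipotentFold, rootPairing_succ]
    · simp [unipotentFold, h]
  | cons z L ih =>
    have ih := ih fun w hw => hx w (List.mem_cons_of_mem _ hw)
    rw [chainSum_cons, add_mul, mul_add, smul_add, ih]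
    congr 1
    split_ifs with h
    · rcases le_or_gt a b with hab | hab
      · rw [mul_assoc, hx z List.mem_cons_self, mul_smul_comm, ← mul_assoc, ih, h,
          rootPairing_eq_add i hab, zpow_add₀ hq, mul_smul, smul_mul_assoc, mul_assoc]
      · rw [chainSum_eq_zero L (by omega)]; simp
    · simp

/-- The relation `y_w y_z = q^{(c w, c z)} y_z y_w` for `z` preceding `w` in a list. -/
def CartanCommute (q : K) (c : α → ℕ) (y : α → R) (z w : α) : Prop :=
  y w * y z = q ^ cartanA (c w) (c z) • (y z * y w)

theorem chainSum_mul_chainSum {q : K} (hq : q ≠ 0) {L : List α}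
    (hL : L.Pairwise (CartanCommute q c y)) {a a' : ℕ} (h : a < a') (h' : a' ≤ b) :
    chainSum c y b L a' * chainSum c y b L a =
      q⁻¹ • (chainSum c y b L a * chainSum c y b L a') := by
  induction L generalizing a a' with
  | nil => simp [unipotentFold, show a ≠ b + 1 by omega]
  | cons z L ih =>
    rw [List.pairwise_cons] at hL
    have ih := @ih hL.2
    have hz (a) := chainSum_mul (b := b) hq hL.1 a
    rw [chainSum_cons, chainSum_cons]
    by_cases h1 : c z = a
    · rw [if_neg (by omega), if_pos h1, add_zero, mul_add, add_mul, smul_add, ih h h']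
      congr 1
      have hz := hz a'
      rcases eq_or_ne a' (a + 1) with rfl | h2
      · have e : rootPairing b (a + 1) (c z) = -1 := by
          unfold rootPairing; split_ifs <;> omega
        rw [e, zpow_neg_one] at hz
        conv_lhs => rw [hz]
        rw [mul_smul_comm, mul_assoc]
      · have e : rootPairing b a' (c z) = 0 := by
          unfold rootPairing; split_ifs <;> omega
        rw [e, zpow_zero, one_smul] at hz
        rw [← mul_assoc, ih (by omega) h', smul_mul_assoc, mul_assoc, hz, mul_assoc]
    · rw [if_neg h1, add_zero]
      split_ifs with h2
      · rw [mul_add, add_mul, smul_add, ih h h']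
        congr 1
        have hz := hz a
        rcases eq_or_ne a' b with rfl | h3
        · have e : rootPairing a' a (c z) = 1 := by
            unfold rootPairing; split_ifs <;> omega
          rw [e, zpow_one] at hz
          rw [chainSum_succ, one_mul, hz, smul_smul, inv_mul_cancel₀ hq, one_smul]
        · have e : rootPairing b a (c z) = 0 := by
            unfold rootPairing; split_ifs <;> omega
          rw [e, zpow_zero, one_smul] at hz
          rw [mul_assoc, ← hz, ← mul_assoc, ih (by omega) (by omega), smul_mul_assoc, mul_assoc]
      · rw [add_zero, ih h h']

theorem chainSum_pow {q : K} {l : ℕ} (hl : Odd l) (hq : IsPrimitiveRoot q l) {L : List α}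
    (hL : L.Pairwise (CartanCommute q c y)) {s : α → K}
    (hs : ∀ z ∈ L, y z ^ l = algebraMap K R (s z)) {a : ℕ} (h : a ≤ b + 1) :
    chainSum c y b L a ^ l = algebraMap K R (chainSum c s b L a) := by
  have hq0 : q ≠ 0 := hq.ne_zero hl.pos.ne'
  induction L generalizing a with
  | nil =>
    simp only [unipotentFold]
    split_ifs <;> simp [hl.pos.ne']
  | cons z L ih =>
    rw [List.pairwise_cons] at hL
    have ih := @ih hL.2 fun w hw => hs w (List.mem_cons_of_mem _ hw)
    rcases h.eq_or_lt with rfl | h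
    · simp [chainSum_succ]
    rw [chainSum_cons, chainSum_cons]
    split_ifs with h1
    · have hz (a) := chainSum_mul (b := b) hq0 hL.1 a
      have hpow : (chainSum c y b L (a + 1) * y z) ^ l =
          chainSum c y b L (a + 1) ^ l * y z ^ l := by
        have h2 := hz (a + 1)
        rw [← inv_smul_eq_iff₀ (zpow_ne_zero _ hq0)] at h2
        rw [mul_pow_of_mul_eq_smul h2.symm, pow_choose_two_eq_one hl, one_smul]
        rw [inv_pow, ← zpow_natCast, zpow_comm, zpow_natCast, hq.pow_eq_one, one_zpow, inv_one]
      have hUV : chainSum c y b L a * (chainSum c y b L (a + 1) * y z) =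
          q ^ 2 • (chainSum c y b L (a + 1) * y z * chainSum c y b L a) := by
        rcases eq_or_ne a b with rfl | h3
        · have e : rootPairing a a (c z) = (2 : ℕ) := by
            unfold rootPairing; split_ifs <;> omega
          rw [chainSum_succ, one_mul, hz, e, zpow_natCast]
        · have e : rootPairing b a (c z) = 1 := by
            unfold rootPairing; split_ifs <;> omega
          have h4 := chainSum_mul_chainSum hq0 hL.2 a.lt_succ_self (show a + 1 ≤ b by omega)
          rw [eq_comm, inv_smul_eq_iff₀ hq0] at h4
          rw [← mul_assoc, h4, smul_mul_assoc, mul_assoc, hz, e, zpow_one, mul_smul_comm,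
            smul_smul, mul_assoc, sq]
      have hq2 : IsPrimitiveRoot (q ^ 2) l :=
        hq.pow_of_coprime 2 (Nat.coprime_two_left.2 hl)
      rw [add_comm, add_pow_of_isPrimitiveRoot hl.pos hq2 hUV, hpow, ih (by omega), ih (by omega),
        hs z List.mem_cons_self, map_add, map_mul, add_comm]
    · rw [add_zero, add_zero, ih h.le]

theorem chainSum_commute {L : List α} {x : R} {a : ℕ}
    (hx : ∀ w ∈ L, a ≤ c w → Commute (y w) x) : Commute (chainSum c y b L a) x := by
  induction L generalizing a with
  | nil => simp only [unipotentFold]; split_ifs <;> simp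
  | cons z L ih =>
    have ih {a'} (h : a ≤ a') : Commute (chainSum c y b L a') x :=
      ih fun w hw hwa => hx w (List.mem_cons_of_mem _ hw) (h.trans hwa)
    rw [chainSum_cons]
    refine (ih le_rfl).add_left ?_
    split_ifs with h
    · exact (ih a.le_succ).mul_left (hx z List.mem_cons_self h.ge)
    · exact Commute.zero_left x

theorem colourSum_mul {r : K} {L : List α} {x : R} {i : ℕ}
    (hx : ∀ w ∈ L, c w = i → y w * x = r • (x * y w)) :
    colourSum c y L i * x = r • (x * colourSum c y L i) := by
  induction L with
  | nil => simp [colourSum]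
  | cons z L ih =>
    have ih := ih fun w hw => hx w (List.mem_cons_of_mem _ hw)
    simp only [colourSum, List.map_cons, List.sum_cons, add_mul, mul_add, smul_add] at ih ⊢
    rw [ih]
    split_ifs with h
    · rw [hx z List.mem_cons_self h]
    · simp

theorem cartanA_comm (i j : ℕ) : cartanA i j = cartanA j i := by
  unfold cartanA
  split_ifs <;> omega

theorem commute_of_cartanA_eq_zero {q : K} {L : List α}
    (hL : L.Pairwise (CartanCommute q c y)) {z w : α} (hz : z ∈ L) (hw : w ∈ L)
    (h : cartanA (c z) (c w) = 0) : Commute (y z) (y w) := by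
  have hP : L.Pairwise fun z w => cartanA (c z) (c w) = 0 → Commute (y z) (y w) := by
    refine hL.imp fun {z w} hzw h0 => ?_
    rw [CartanCommute, cartanA_comm, h0, zpow_zero, one_smul] at hzw
    exact hzw.symm
  have : Std.Symm fun z w => cartanA (c z) (c w) = 0 → Commute (y z) (y w) :=
    ⟨fun z w hzw h0 => (hzw (cartanA_comm _ _ ▸ h0)).symm⟩
  exact hP.forall_of_forall (fun z _ _ => Commute.refl _) hz hw h

theorem colourSum_commutator {q : K} (hq : q ≠ 0) {L : List α}
    (hL : L.Pairwise (CartanCommute q c y)) {a : ℕ} (h : a < b) :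
    q⁻¹ • (chainSum c y b L (a + 1) * colourSum c y L a) -
      colourSum c y L a * chainSum c y b L (a + 1) = (q⁻¹ - q) • chainSum c y b L a := by
  induction L with
  | nil => simp [colourSum, unipotentFold, show a ≠ b + 1 by omega]
  | cons z L ih =>
    rw [List.pairwise_cons] at hL
    have ih := ih hL.2
    have hz (a) := chainSum_mul (b := b) hq hL.1 a
    have hcons : colourSum c y (z :: L) a = (if c z = a then y z else 0) + colourSum c y L a := by
      simp [colourSum]
    rw [chainSum_cons, chainSum_cons, hcons]
    by_cases h1 : c z = a
    · have e : rootPairing b (a + 1) (c z) = -1 := by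
        unfold rootPairing; split_ifs <;> omega
      have hz := hz (a + 1)
      rw [e, zpow_neg_one, eq_comm, inv_smul_eq_iff₀ hq] at hz
      rw [if_pos h1, if_neg (by omega), if_pos h1, add_zero, smul_add, ← ih, mul_add, add_mul, hz]
      simp only [sub_smul, smul_add]
      abel
    · rw [if_neg h1, if_neg h1, zero_add, add_zero, ← ih]
      split_ifs with h2
      · have h3 : chainSum c y b L (a + 1 + 1) * colourSum c y L a =
            colourSum c y L a * chainSum c y b L (a + 1 + 1) := by
          refine (chainSum_commute fun w hw hwa => ?_).eq
          rw [commute_iff_eq, eq_comm, ← one_smul K (y w * _)]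
          refine colourSum_mul fun v hv hva => ?_
          rw [one_smul]
          exact commute_of_cartanA_eq_zero hL.2 hv hw
            (by unfold cartanA; split_ifs <;> omega)
        have h4 : y z * colourSum c y L a = q • (colourSum c y L a * y z) := by
          rw [colourSum_mul (r := q⁻¹), smul_inv_smul₀ hq]
          intro w hw hc
          have := hL.1 w hw
          rwa [CartanCommute, show cartanA (c w) (c z) = -1 by unfold cartanA; split_ifs <;> omega,
            zpow_neg_one] at this
        rw [add_mul, mul_add, mul_assoc, h4, mul_smul_comm, ← mul_assoc, h3, smul_add, smul_smul,
          inv_mul_cancel₀ hq, one_smul, mul_assoc]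
        abel
      · simp

/-- The root vectors generated by a family `e` of elements, with `rootVector q e g j` being the
root vector of the root `α_j + ⋯ + α_{j+g}`. -/
def rootVector (q : K) (e : ℕ → R) : ℕ → ℕ → R
  | 0, j => e j
  | g + 1, j => q⁻¹ • (rootVector q e g (j + 1) * e j) - e j * rootVector q e g (j + 1)

theorem rootVector_eq_smul_chainSum {q : K} (hq : q ≠ 0) {L : List α}
    (hL : L.Pairwise (CartanCommute q c y)) {e : ℕ → R} {g a : ℕ} (hb : a + g = b)
    (he : ∀ i, a ≤ i → i ≤ b → e i = colourSum c y L i) :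
    rootVector q e g a = (q⁻¹ - q) ^ g • chainSum c y b L a := by
  induction g generalizing a with
  | zero =>
    obtain rfl : a = b := hb
    simp [rootVector, he, chainSum_self]
  | succ g ih =>
    rw [rootVector, ih (by omega) fun i hi => he i (by omega), he a le_rfl (by omega), pow_succ,
      mul_smul, ← colourSum_commutator hq hL (show a < b by omega)]
    simp only [smul_mul_assoc, mul_smul_comm, smul_sub]
    rw [smul_comm q⁻¹]

theorem rootVector_pow_eq_zero {W : List α} {c : α × Bool → ℕ} {y : α × Bool → R}
    {s : α × Bool → K} {q : K} {l : ℕ} (hl : Odd l) (hq : IsPrimitiveRoot q l)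
    (hc : ∀ p, c (p, true) = c (p, false)) (hs : ∀ p, s (p, true) = - s (p, false))
    (hL : (W.map (·, true) ++ (W.map (·, false)).reverse).Pairwise (CartanCommute q c y))
    (hy : ∀ z ∈ W.map (·, true) ++ (W.map (·, false)).reverse, y z ^ l = algebraMap K R (s z))
    {e : ℕ → R} (g a : ℕ) (he : ∀ i, a ≤ i → i ≤ a + g →
      e i = colourSum c y (W.map (·, true) ++ (W.map (·, false)).reverse) i) :
    rootVector q e g a ^ l = 0 := by
  rw [rootVector_eq_smul_chainSum (hq.ne_zero hl.pos.ne') hL rfl he, smul_pow,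
    chainSum_pow hl hq hL hy (by omega), chainSum, unipotentFold_palindrome c s hc hs, if_neg,
    map_zero, smul_zero]
  omega

end ChainSum

section Weyl

variable {l n : ℕ} {q : ℂ}

theorem epow_zero : epow q (0 : ZMod l) = 1 := by simp [epow]

theorem epow_add [NeZero l] (hq : q ^ l = 1) (x y : ZMod l) :
    epow q (x + y) = epow q x * epow q y := by
  rw [epow, epow, epow, ← pow_add, ZMod.val_add, ← pow_eq_pow_mod _ hq]

theorem epow_intCast [NeZero l] (hq : q ^ l = 1) (t : ℤ) :
    epow q (t : ZMod l) = q ^ t := by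
  have h : ((t : ZMod l).val : ℤ) = t % l := ZMod.val_intCast t
  have hq0 : q ≠ 0 := by
    rintro rfl
    simp [NeZero.ne l] at hq
  rw [epow, ← zpow_natCast, h]
  conv_rhs => rw [← Int.emod_add_mul_ediv t l, zpow_add₀ hq0, zpow_mul, zpow_natCast, hq, one_zpow,
    mul_one]

theorem epow_inv (x : ZMod l) : (epow q x)⁻¹ = epow q⁻¹ x := by simp [epow]

theorem diagOp_single (f : Mt l n → ℂ) (m : Mt l n) (x : ℂ) :
    diagOp f (Finsupp.single m x) = Finsupp.single m (f m * x) := by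
  simp [diagOp]

theorem shiftOp_single (ξ m : Mt l n) (x : ℂ) :
    shiftOp ξ (Finsupp.single m x) = Finsupp.single (m + ξ) x := by
  simp [shiftOp]

theorem diagOp_mul (f g : Mt l n → ℂ) : diagOp f * diagOp g = diagOp fun m => f m * g m := by
  ext m : 2
  simp [diagOp_single]

theorem shiftOp_mul (ξ η : Mt l n) : shiftOp ξ * shiftOp η = shiftOp (ξ + η) := by
  refine Finsupp.lhom_ext fun m x => ?_
  rw [Module.End.mul_apply, shiftOp_single, shiftOp_single, shiftOp_single, add_assoc, add_comm η]

theorem shiftOp_zero : shiftOp (0 : Mt l n) = 1 := by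
  refine Finsupp.lhom_ext fun m x => ?_
  rw [shiftOp_single, add_zero, Module.End.one_apply]

theorem shiftOp_pow (ξ : Mt l n) (t : ℕ) : shiftOp ξ ^ t = shiftOp (t • ξ) := by
  induction t with
  | zero => rw [pow_zero, zero_smul, shiftOp_zero]
  | succ t ih => rw [pow_succ, ih, shiftOp_mul, succ_nsmul]

/-- The Weyl operator `u_m ↦ q^{a(m + ζ)} u_{m + ζ}`. -/
def weylOp (q : ℂ) (a : Mt l n →+ ZMod l) (ζ : Mt l n) : Module.End ℂ (Vsp l n) :=
  diagOp (fun m => epow q (a m)) * shiftOp ζ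

theorem weylOp_single (a : Mt l n →+ ZMod l) (ζ m : Mt l n) (x : ℂ) :
    weylOp q a ζ (Finsupp.single m x) = Finsupp.single (m + ζ) (epow q (a (m + ζ)) * x) := by
  rw [weylOp, Module.End.mul_apply, shiftOp_single, diagOp_single]

theorem weylOp_mul [NeZero l] (hq : q ^ l = 1) (a a' : Mt l n →+ ZMod l) (ζ ζ' : Mt l n) {t : ℤ}
    (ht : a ζ' - a' ζ = t) :
    weylOp q a ζ * weylOp q a' ζ' = q ^ t • (weylOp q a' ζ' * weylOp q a ζ) := by
  refine Finsupp.lhom_ext fun m x => ?_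
  rw [LinearMap.smul_apply, Module.End.mul_apply, Module.End.mul_apply, weylOp_single,
    weylOp_single, weylOp_single, weylOp_single, Finsupp.smul_single, add_right_comm, smul_eq_mul,
    ← epow_intCast hq, ← ht]
  simp only [← mul_assoc, ← epow_add hq, map_add]
  congr 3
  abel

theorem weylOp_pow [NeZero l] (hl : Odd l) (hq : q ^ l = 1) (a : Mt l n →+ ZMod l) (ζ : Mt l n) :
    weylOp q a ζ ^ l = 1 := by
  have key (t : ℕ) (m : Mt l n) (x : ℂ) : (weylOp q a ζ ^ t) (Finsupp.single m x) =
      Finsupp.single (m + t • ζ) (epow q (t • a m + (t + 1).choose 2 • a ζ) * x) := by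
    induction t with
    | zero => simp [epow_zero]
    | succ t ih =>
      rw [pow_succ', Module.End.mul_apply, ih, weylOp_single, ← mul_assoc, ← epow_add hq,
        add_assoc m, succ_nsmul, Nat.choose_succ_succ' (t + 1) 1, Nat.choose_one_right]
      have harg : a (m + (t • ζ + ζ)) + (t • a m + (t + 1).choose 2 • a ζ) =
          (t + 1) • a m + (t + 1 + (t + 1).choose (1 + 1)) • a ζ := by
        simp only [map_add, map_nsmul, add_smul, one_smul]
        abel
      rw [harg]
  have hchoose : l ∣ (l + 1).choose 2 := by
    obtain ⟨t, rfl⟩ := hl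
    refine ⟨t + 1, ?_⟩
    rw [Nat.choose_two_right, Nat.add_sub_cancel, show (2 * t + 1 + 1) * (2 * t + 1) =
      2 * ((2 * t + 1) * (t + 1)) by ring, Nat.mul_div_cancel_left _ two_pos]
  obtain ⟨r, hr⟩ := hchoose
  refine Finsupp.lhom_ext fun m x => ?_
  have hζ : l • ζ = 0 := by ext p; simp
  rw [key, hζ, hr]
  simp [epow_zero]

theorem braceShift_inv (c : ℂ) (ζ : Mt l n) :
    braceShift l n q c ζ = braceShift l n q⁻¹ c⁻¹ (-ζ) := by
  rw [braceShift, braceShift, inv_inv, inv_inv, neg_neg, ← neg_sub q, inv_neg]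
  module

/-- A sum of terms `q^a {c_i W}`, for `W` running through the shifts attached to the pairs
`(i, k)`, generates nilpotent root vectors as soon as the pairing of the diagonal
parts `a` with the shifts is triangular and is given by the Cartan matrix. -/
theorem rootVector_weyl_pow_eq_zero [NeZero l] (hl : Odd l) (hq : IsPrimitiveRoot q l)
    (W : List (ℕ × ℕ)) (A : ℕ × ℕ → Mt l n →+ ZMod l) (ζ : ℕ × ℕ → Mt l n) (c : ℕ → ℂ)
    (hc : ∀ i, c i ^ l = 1) (hdiag : ∀ p ∈ W, A p (ζ p) = 1)
    (htri : W.Pairwise fun p p' => A p' (ζ p) = cartanA p'.1 p.1 ∧ A p (ζ p') = 0)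
    {e : ℕ → Module.End ℂ (Vsp l n)} (g a : ℕ)
    (he : ∀ i, a ≤ i → i ≤ a + g → e i = (W.map fun p => if p.1 = i then
      diagOp (fun m => epow q (A p m)) * braceShift l n q (c i) (ζ p) else 0).sum) :
    rootVector q e g a ^ l = 0 := by
  set κ := (q - q⁻¹)⁻¹
  let y : (ℕ × ℕ) × Bool → Module.End ℂ (Vsp l n) := fun z =>
    (if z.2 then κ * c z.1.1 else -(κ * (c z.1.1)⁻¹)) •
      weylOp q (A z.1) (if z.2 then ζ z.1 else -ζ z.1)
  let s : (ℕ × ℕ) × Bool → ℂ := fun z => if z.2 then κ ^ l else - κ ^ l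
  have hql := hq.pow_eq_one
  have hcomm {z w : (ℕ × ℕ) × Bool} {t : ℤ}
      (h : A w.1 (if z.2 then ζ z.1 else -ζ z.1) - A z.1 (if w.2 then ζ w.1 else -ζ w.1) = t) :
      y w * y z = q ^ t • (y z * y w) := by
    simp only [y]
    rw [smul_mul_smul_comm, weylOp_mul hql _ _ _ _ h, smul_mul_smul_comm, smul_comm, mul_comm]
  refine rootVector_pow_eq_zero (W := W) (c := fun z => z.1.1) (y := y) (s := s) hl hq
    (fun _ => rfl) (fun _ => by simp [s]) ?_ ?_ g a ?_
  · rw [List.pairwise_append, List.pairwise_reverse, List.pairwise_map, List.pairwise_map]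
    refine ⟨htri.imp fun {p p'} h => hcomm ?_, htri.imp fun {p p'} h => hcomm ?_, ?_⟩
    · simp [h]
    · simp [h, cartanA_comm p.1]
    · simp only [List.mem_map, List.mem_reverse]
      rintro _ ⟨p, hp, rfl⟩ _ ⟨p', hp', rfl⟩
      refine hcomm ?_
      have hsym : W.Pairwise fun p p' => A p' (ζ p) + A p (ζ p') = cartanA p'.1 p.1 :=
        htri.imp fun h => by rw [h.1, h.2, add_zero]
      have : Std.Symm fun p p' : ℕ × ℕ => A p' (ζ p) + A p (ζ p') = cartanA p'.1 p.1 :=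
        ⟨fun p p' h => by rw [add_comm, h, cartanA_comm]⟩
      have : A p' (ζ p) + A p (ζ p') = cartanA p'.1 p.1 :=
        hsym.forall_of_forall (fun p hp => by simp [hdiag p hp, cartanA, one_add_one_eq_two]) hp hp'
      simpa using this
  · rintro ⟨p, b⟩ -
    simp only [y, s]
    rw [smul_pow, weylOp_pow hl hql, Algebra.algebraMap_eq_smul_one]
    cases b <;> simp [hl.neg_pow, mul_pow, hc]
  · intro i hai hig
    rw [he i hai hig, colourSum, List.map_append, List.sum_append, List.map_reverse,
      (List.reverse_perm _).sum_eq, List.map_map, List.map_map, ← List.sum_map_add]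
    congr 1
    refine List.map_congr_left fun p _ => ?_
    simp only [Function.comp]
    split_ifs with h
    · simp only [y, h, weylOp, braceShift]
      refine LinearMap.ext fun v => ?_
      simp only [Module.End.mul_apply, LinearMap.smul_apply, LinearMap.sub_apply,
        LinearMap.add_apply, map_smul, map_sub, if_true, Bool.false_eq_true, if_false]
      module
    · simp

end Weyl

section Entries

variable {l n : ℕ}

/-- The `(j,k)`-entry as a homomorphism. -/
def entryHom (j k : ℕ) : Mt l n →+ ZMod l where
  toFun m := mval m j k
  map_zero' := by simp [mval]
  map_add' m m' := by unfold mval; split_ifs <;> simp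

theorem entryHom_dlt (j k j' k' : ℕ) : entryHom j k (dlt j' k' : Mt l n) =
    if j = j' ∧ k = k' ∧ 1 ≤ j ∧ j ≤ k ∧ k ≤ n then 1 else 0 := by
  simp only [entryHom, mval, dlt, AddMonoidHom.coe_mk, ZeroHom.coe_mk, Prod.mk.injEq]
  split_ifs <;> first | rfl | omega

theorem prod_ofFn_diagOp [NeZero l] {q : ℂ} (hq : q ^ l = 1) (b : ℕ → Mt l n →+ ZMod l) (N : ℕ) :
    (List.ofFn fun t : Fin N => diagOp fun m => epow q (b t m)).prod =
      diagOp fun m => epow q ((∑ t ∈ Finset.range N, b t) m) := by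
  induction N generalizing b with
  | zero =>
    refine Finsupp.lhom_ext fun m x => ?_
    simp [diagOp_single, epow_zero]
  | succ N ih =>
    rw [List.ofFn_succ, List.prod_cons]
    have := ih fun t => b (t + 1)
    simp only [Fin.val_succ, Fin.val_zero] at this ⊢
    rw [this, diagOp_mul, Finset.sum_range_succ']
    simp only [← epow_add hq, AddMonoidHom.add_apply]
    simp only [add_comm]

/-- The exponent of `X_{ik} X_{i,k+1} ⋯ X_{in}`. -/
def rowHom (l n i k : ℕ) : Mt l n →+ ZMod l :=
  ∑ t ∈ Finset.range (n + 1 - k), entryHom i (k + t)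

/-- The exponent of `X_{i+1-k,n+1-k} X_{i+2-k,n+2-k} ⋯ X_{i,n}`. -/
def diagonalHom (l n i k : ℕ) : Mt l n →+ ZMod l :=
  ∑ t ∈ Finset.range k, entryHom (i + 1 - k + t) (n + 1 - k + t)

theorem rowHom_dlt (i k j' k' : ℕ) : rowHom l n i k (dlt j' k') =
    if i = j' ∧ k ≤ k' ∧ 1 ≤ j' ∧ j' ≤ k' ∧ k' ≤ n then 1 else 0 := by
  rw [rowHom, AddMonoidHom.finsetSum_apply]
  simp only [entryHom_dlt]
  split_ifs with h
  · rw [Finset.sum_eq_single (k' - k)]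
    · rw [if_pos (by omega)]
    · intro t _ ht
      rw [if_neg (by omega)]
    · intro ht
      simp at ht
      omega
  · exact Finset.sum_eq_zero fun t ht => if_neg (by omega)

theorem diagonalHom_dlt {i k : ℕ} (hki : k ≤ i) (hin : i ≤ n) (j' k' : ℕ) :
    diagonalHom l n i k (dlt j' k') =
      if i + 1 - k ≤ j' ∧ j' ≤ i ∧ k' + i = n + j' ∧ 1 ≤ j' then 1 else 0 := by
  rw [diagonalHom, AddMonoidHom.finsetSum_apply]
  simp only [entryHom_dlt]
  split_ifs with h
  · rw [Finset.sum_eq_single (j' - (i + 1 - k))]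
    · rw [if_pos (by omega)]
    · intro t _ ht
      rw [if_neg (by omega)]
    · intro ht
      simp at ht
      omega
  · exact Finset.sum_eq_zero fun t ht => if_neg (by simp at ht; omega)

theorem XprodE_eq [NeZero l] {ε : ℂ} (hε : ε ^ l = 1) (i k : ℕ) :
    XprodE l n ε i k = diagOp fun m => epow ε (rowHom l n i k m) :=
  prod_ofFn_diagOp hε (fun t => entryHom i (k + t)) (n + 1 - k)

theorem XprodF_eq [NeZero l] {ε : ℂ} (hε : ε ^ l = 1) (i k : ℕ) :
    XprodF l n ε i k = diagOp fun m => epow ε⁻¹ (diagonalHom l n i k m) := by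
  rw [diagonalHom, ← prod_ofFn_diagOp (by rw [inv_pow, hε, inv_one])]
  simp only [XprodF, XopInv, epow_inv]
  rfl

theorem rowHom_zetaE_self {i k : ℕ} (hi : 1 ≤ i) (hik : i ≤ k) (hk : k ≤ n) :
    rowHom l n i k (zetaE l n i k) = 1 := by
  simp only [zetaE, map_add, map_sub, rowHom_dlt, true_and]
  split_ifs <;> first | (exfalso; omega) | simp

theorem rowHom_zetaE {i k i' k' : ℕ} (hi : 1 ≤ i) (hik : i ≤ k) (hk : k ≤ n)
    (hi' : 1 ≤ i') (hik' : i' ≤ k') (hk' : k' ≤ n) (h : k' < k ∨ k = k' ∧ i < i') :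
    rowHom l n i' k' (zetaE l n i k) = cartanA i' i ∧ rowHom l n i k (zetaE l n i' k') = 0 := by
  simp only [zetaE, map_add, map_sub, rowHom_dlt, cartanA]
  constructor
  · split_ifs <;> first | (exfalso; omega) | simp [one_add_one_eq_two]
  · split_ifs <;> first | (exfalso; omega) | simp

theorem diagonalHom_zetaF_self {i k : ℕ} (hk : 1 ≤ k) (hik : k ≤ i) (hi : i ≤ n) :
    diagonalHom l n i k (-zetaF l n i k) = 1 := by
  simp only [zetaF, map_neg, map_add, map_sub, diagonalHom_dlt hik hi]
  split_ifs <;> first | (exfalso; omega) | simp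

theorem diagonalHom_zetaF {i k i' k' : ℕ} (hk : 1 ≤ k) (hik : k ≤ i) (hi : i ≤ n)
    (hk' : 1 ≤ k') (hik' : k' ≤ i') (hi' : i' ≤ n) (h : k < k' ∨ k = k' ∧ i' < i) :
    diagonalHom l n i' k' (-zetaF l n i k) = cartanA i' i ∧
      diagonalHom l n i k (-zetaF l n i' k') = 0 := by
  simp only [zetaF, map_neg, map_add, map_sub, diagonalHom_dlt hik hi, diagonalHom_dlt hik' hi',
    cartanA]
  constructor
  · split_ifs <;> first | (exfalso; omega) | simp [one_add_one_eq_two]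
  · split_ifs <;> first | (exfalso; omega) | simp

end Entries

/-- A finite set can be listed in increasing order of an injective function. -/
theorem Finset.exists_list_pairwise_lt {α β : Type*} [DecidableEq α] [LinearOrder β] {f : α → β}
    (hf : Function.Injective f) (P : Finset α) :
    ∃ W : List α, W.Nodup ∧ W.toFinset = P ∧ W.Pairwise fun p p' => f p < f p' := by
  let := LinearOrder.lift' f hf
  exact ⟨P.sort, P.sort_nodup _, P.sort_toFinset _, (P.sortedLT_sort).pairwise⟩

theorem ErootAux_eq_rootVector (l n : ℕ) (ε : ℂ) (g j : ℕ) :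
    ErootAux l n ε g j = rootVector ε (Esp l n ε) g j := by
  induction g generalizing j with
  | zero => rfl
  | succ g ih => rw [ErootAux, rootVector, ih]

theorem FrootAux_eq_rootVector (l n : ℕ) (ε : ℂ) (lam : ℕ → ℕ) (g j : ℕ) :
    FrootAux l n ε lam g j = rootVector ε⁻¹ (Fsp l n ε lam) g j := by
  induction g generalizing j with
  | zero => rfl
  | succ g ih => rw [FrootAux, rootVector, ih, inv_inv]

theorem Eroot_pow_eq_zero {l n : ℕ} (hl : Odd l) {ε : ℂ} (hε : IsPrimitiveRoot ε l)
    {j k : ℕ} (hj : 1 ≤ j) : Eroot l n ε j k ^ l = 0 := by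
  have : NeZero l := ⟨hl.pos.ne'⟩
  obtain ⟨W, hW, hWP, hlt⟩ := Finset.exists_list_pairwise_lt
    (f := fun p : ℕ × ℕ => toLex (OrderDual.toDual p.2, p.1))
    (fun p p' h => by simpa [Prod.ext_iff, and_comm] using h)
    ((Finset.Icc 1 n ×ˢ Finset.Icc 1 n).filter fun p => p.1 ≤ p.2)
  have hmem {p : ℕ × ℕ} (hp : p ∈ W) : 1 ≤ p.1 ∧ p.1 ≤ p.2 ∧ p.2 ≤ n := by
    rw [← List.mem_toFinset, hWP] at hp
    simp at hp
    omega
  rw [Eroot, ErootAux_eq_rootVector]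
  refine rootVector_weyl_pow_eq_zero hl hε W (fun p => rowHom l n p.1 p.2)
    (fun p => zetaE l n p.1 p.2) (fun _ => 1) (fun _ => one_pow l) ?_ ?_ _ _ ?_
  · intro p hp
    obtain ⟨h1, h2, h3⟩ := hmem hp
    exact rowHom_zetaE_self h1 h2 h3
  · refine hlt.imp_of_mem fun {p p'} hp hp' h => ?_
    obtain ⟨h1, h2, h3⟩ := hmem hp
    obtain ⟨h1', h2', h3'⟩ := hmem hp'
    exact rowHom_zetaE h1 h2 h3 h1' h2' h3' (by simpa [Prod.Lex.toLex_lt_toLex] using h)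
  · intro i hi hik
    rw [← List.sum_toFinset _ hW, hWP, ← Finset.sum_filter, Esp]
    refine Finset.sum_nbij' (fun k => (i, k)) Prod.snd ?_ ?_ ?_ ?_ ?_
    · simp; omega
    · simp; omega
    · simp
    · simp +contextual [Prod.ext_iff]
    · intro k _
      rw [XprodE_eq hε.pow_eq_one]

theorem Froot_pow_eq_zero {l n : ℕ} (hl : Odd l) {ε : ℂ} (hε : IsPrimitiveRoot ε l) (lam : ℕ → ℕ)
    {j k : ℕ} (hjk : j ≤ k) (hk : k ≤ n) : Froot l n ε lam j k ^ l = 0 := by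
  have : NeZero l := ⟨hl.pos.ne'⟩
  obtain ⟨W, hW, hWP, hlt⟩ := Finset.exists_list_pairwise_lt
    (f := fun p : ℕ × ℕ => toLex (p.2, OrderDual.toDual p.1))
    (fun p p' h => by simpa [Prod.ext_iff, and_comm] using h)
    ((Finset.Icc 1 n ×ˢ Finset.Icc 1 n).filter fun p => p.2 ≤ p.1)
  have hmem {p : ℕ × ℕ} (hp : p ∈ W) : 1 ≤ p.2 ∧ p.2 ≤ p.1 ∧ p.1 ≤ n := by
    rw [← List.mem_toFinset, hWP] at hp
    simp at hp
    omega
  rw [Froot, FrootAux_eq_rootVector]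
  refine rootVector_weyl_pow_eq_zero hl hε.inv W (fun p => diagonalHom l n p.1 p.2)
    (fun p => -zetaF l n p.1 p.2) (fun i => ε ^ lam i) (fun i => ?_) ?_ ?_ _ _ ?_
  · rw [pow_right_comm, hε.pow_eq_one, one_pow]
  · intro p hp
    obtain ⟨h1, h2, h3⟩ := hmem hp
    exact diagonalHom_zetaF_self h1 h2 h3
  · refine hlt.imp_of_mem fun {p p'} hp hp' h => ?_
    obtain ⟨h1, h2, h3⟩ := hmem hp
    obtain ⟨h1', h2', h3'⟩ := hmem hp'
    exact diagonalHom_zetaF h1 h2 h3 h1' h2' h3' (by simpa [Prod.Lex.toLex_lt_toLex] using h)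
  · intro i hi hik
    rw [← List.sum_toFinset _ hW, hWP, ← Finset.sum_filter, Fsp]
    refine Finset.sum_nbij' (fun k => (i, k)) Prod.snd ?_ ?_ ?_ ?_ ?_
    · simp; omega
    · simp; omega
    · simp
    · simp +contextual [Prod.ext_iff]
    · intro k _
      rw [XprodF_eq hε.pow_eq_one, braceShift_inv, inv_inv]

theorem Tsp_pow_eq_one {l n : ℕ} {ε : ℂ} (hε : ε ^ l = 1) (lam : ℕ → ℕ) (i : ℕ) :
    Tsp l n ε lam i ^ (2 * l) = 1 := by
  have hζ : (2 * l) • zetaT l n i = 0 := by ext p; simp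
  rw [Tsp, smul_pow, shiftOp_pow, hζ, shiftOp_zero, ← pow_mul, ← mul_assoc, mul_comm, pow_mul, hε,
    one_pow, one_smul]

theorem nilpotency_of_root_vectors (l n : ℕ) (hlodd : Odd l) (hl : 1 < l)
    (ε : ℂ) (hε : IsPrimitiveRoot ε l) (hn : 1 ≤ n)
    (lam : ℕ → ℕ) (hlam : ∀ i, lam i < l) :
    (∀ j k, 1 ≤ j → j ≤ k → k ≤ n →
      Eroot l n ε j k ^ l = 0 ∧ Froot l n ε lam j k ^ l = 0) ∧
    (∀ i, 1 ≤ i → i ≤ n → Tsp l n ε lam i ^ (2 * l) = 1) :=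
  ⟨fun _ _ hj hjk hk => ⟨Eroot_pow_eq_zero hlodd hε hj,
    Froot_pow_eq_zero hlodd hε lam hjk hk⟩, fun i _ _ => Tsp_pow_eq_one hε.pow_eq_one lam i⟩
end
end
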